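/- Let m ≥ 2 and n ≥ 1 be integers and let 𝒜, ℬ be symmetric m-th order n-dimensional real tensors with 𝒜 strictly copositive. Then the maximum φ₀^max of φ₀ over the feasible set F is attained, the set of m-degree Pareto-eigenvalues of (𝒜, ℬ, −ℐ) is nonempty and admits a maximum λ_max, and λ_max^{m-1} = φ₀^max. -/

import Mathlib

open Finset

/-- `𝒜x^{m-1}` for an `(k+1)`-th order `n`-dimensional tensor `A`. -/
noncomputable def tApply {n k : ℕ} (A : (Fin (k + 1) → Fin n) → ℝ) (x : Fin n → ℝ) :
    Fin n → ℝ :=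
  fun i => ∑ g : Fin k → Fin n, A (Fin.cons i g) * ∏ j, x (g j)

/-- `𝒜x^m` for an `m`-th order `n`-dimensional tensor `A`. -/
noncomputable def tEval {n m : ℕ} (A : (Fin m → Fin n) → ℝ) (x : Fin n → ℝ) : ℝ :=
  ∑ f : Fin m → Fin n, A f * ∏ j, x (f j)

/-- the tensor `λ^m 𝒜 + λ ℬ + 𝒞` where `m = k + 2`. -/
noncomputable def triple {n k : ℕ} (A B C : (Fin (k + 2) → Fin n) → ℝ) (lam : ℝ) :
    (Fin (k + 2) → Fin n) → ℝ :=
  fun f => lam ^ (k + 2) * A f + lam * B f + C f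

/-- `(λ, x)` is an `m`-degree Pareto-eigenpair of the triplet `(A, B, C)`, `m = k + 2`. -/
noncomputable def IsParetoPair {n k : ℕ} (A B C : (Fin (k + 2) → Fin n) → ℝ)
    (lam : ℝ) (x : Fin n → ℝ) : Prop :=
  x ≠ 0 ∧ (∀ i, 0 ≤ x i) ∧ (∀ i, 0 ≤ tApply (triple A B C lam) x i) ∧
    (∑ i, x i * tApply (triple A B C lam) x i) = 0

/-- the unit tensor `ℐ`: entries `1` if all indices coincide and `0` otherwise. -/
noncomputable def unitT {n k : ℕ} : (Fin (k + 2) → Fin n) → ℝ :=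
  fun f => if ∀ t, f t = f 0 then 1 else 0

/-- a tensor is symmetric if its entries are invariant under permutations of the indices. -/
def IsSymm' {n m : ℕ} (A : (Fin m → Fin n) → ℝ) : Prop :=
  ∀ (σ : Equiv.Perm (Fin m)) (f : Fin m → Fin n), A (f ∘ σ) = A f

/-- the objective `φ₀(u,v) = m(m-1)^{1/m−1} v^⊤ u^{[m-1]} − ℬu^m`, `m = k + 2`. -/
noncomputable def phi0 {n k : ℕ} (B : (Fin (k + 2) → Fin n) → ℝ) (u v : Fin n → ℝ) : ℝ :=
  (k + 2 : ℝ) * ((k + 1 : ℝ) ^ ((1 : ℝ) / (k + 2) - 1)) * (∑ i, v i * u i ^ (k + 1)) -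
    tEval B u

/-- membership in the feasible set `F = {(u,v) ≥ 0 : 𝒜u^m + ∑ v_i^m = 1}`. -/
noncomputable def Feasible {n k : ℕ} (A : (Fin (k + 2) → Fin n) → ℝ) (u v : Fin n → ℝ) :
    Prop :=
  (∀ i, 0 ≤ u i) ∧ (∀ i, 0 ≤ v i) ∧ tEval A u + ∑ i, v i ^ (k + 2) = 1

theorem tEval_eq_sum_tApply {n k : ℕ} (T : (Fin (k + 1) → Fin n) → ℝ) (x : Fin n → ℝ) :
    tEval T x = ∑ i, x i * tApply T x i := by
  unfold tEval tApply
  rw [← (Fin.consEquiv fun _ : Fin (k + 1) => Fin n).sum_comp, Fintype.sum_prod_type]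
  refine sum_congr rfl fun i _ => ?_
  rw [mul_sum]
  refine sum_congr rfl fun g _ => ?_
  change T (Fin.cons i g) * ∏ j, x ((Fin.cons i g : Fin (k + 1) → Fin n) j) = _
  simp only [Fin.prod_univ_succ, Fin.cons_zero, Fin.cons_succ]
  ring

theorem tEval_smul {n m : ℕ} (T : (Fin m → Fin n) → ℝ) (s : ℝ) (x : Fin n → ℝ) :
    tEval T (s • x) = s ^ m * tEval T x := by
  unfold tEval
  rw [mul_sum]
  refine sum_congr rfl fun f _ => ?_
  simp only [Pi.smul_apply, smul_eq_mul, prod_mul_distrib, prod_const, card_univ,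
    Fintype.card_fin]
  ring

theorem continuous_tEval {n m : ℕ} (T : (Fin m → Fin n) → ℝ) : Continuous (tEval T) := by
  unfold tEval
  fun_prop

theorem tEval_unitT {n k : ℕ} (x : Fin n → ℝ) :
    tEval (unitT (k := k)) x = ∑ i, x i ^ (k + 2) := by
  rw [tEval_eq_sum_tApply]
  refine sum_congr rfl fun i _ => ?_
  unfold tApply
  rw [sum_eq_single (fun _ => i)]
  · have h : ∀ t : Fin (k + 2), (Fin.cons i fun _ : Fin (k + 1) => i : Fin (k + 2) → Fin n) t
        = i := fun t => by cases t using Fin.cases <;> simp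
    simp [unitT, h]
    ring
  · intro g _ hg
    rw [unitT, if_neg, zero_mul]
    intro h
    exact hg (funext fun t => by simpa using h t.succ)
  · simp

theorem tEval_triple {n k : ℕ} (A B C : (Fin (k + 2) → Fin n) → ℝ) (lam : ℝ)
    (x : Fin n → ℝ) :
    tEval (triple A B C lam) x =
      lam ^ (k + 2) * tEval A x + lam * tEval B x + tEval C x := by
  simp only [tEval, triple, mul_sum, ← sum_add_distrib]
  exact sum_congr rfl fun f _ => by ring

theorem tEval_triple_neg_unitT {n k : ℕ} (A B : (Fin (k + 2) → Fin n) → ℝ) (lam : ℝ)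
    (x : Fin n → ℝ) :
    tEval (triple A B (fun f => -unitT f) lam) x =
      lam ^ (k + 2) * tEval A x + lam * tEval B x - ∑ i, x i ^ (k + 2) := by
  rw [tEval_triple, ← tEval_unitT]
  simp only [tEval, neg_mul, sum_neg_distrib]
  ring

theorem isSymm'_triple_neg_unitT {n k : ℕ} {A B : (Fin (k + 2) → Fin n) → ℝ}
    (hA : IsSymm' A) (hB : IsSymm' B) (lam : ℝ) :
    IsSymm' (triple A B (fun f => -unitT f) lam) := by
  intro σ f
  have hU : unitT (f ∘ σ) = unitT f := by
    unfold unitT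
    congr 1
    apply propext
    constructor
    · intro h t
      have key : ∀ t, f t = f (σ 0) := fun t => by simpa using h (σ.symm t)
      rw [key t, key 0]
    · intro h t
      simp [h (σ t), h (σ 0)]
  simp only [triple, hA σ f, hB σ f, hU]

/-- The partial derivatives of the form of a symmetric tensor. -/
theorem hasDerivAt_tEval_add_single {n k : ℕ} {T : (Fin (k + 1) → Fin n) → ℝ}
    (hT : IsSymm' T) (u : Fin n → ℝ) (i : Fin n) :
    HasDerivAt (fun s : ℝ => tEval T (u + s • Pi.single i 1))
      ((k + 1 : ℝ) * tApply T u i) 0 := by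
  have hlin : ∀ l : Fin n, HasDerivAt (fun s : ℝ => u l + s * (Pi.single i 1 : Fin n → ℝ) l)
      ((Pi.single i 1 : Fin n → ℝ) l) 0 := fun l => by
    simpa using ((hasDerivAt_id (0 : ℝ)).mul_const _).const_add (u l)
  have hD : HasDerivAt (fun s : ℝ => tEval T (u + s • Pi.single i 1))
      (∑ f : Fin (k + 1) → Fin n, T f *
        ∑ j, (∏ l ∈ univ.erase j, u (f l)) * (Pi.single i 1 : Fin n → ℝ) (f j)) 0 := by
    unfold tEval
    refine HasDerivAt.fun_sum fun f _ => HasDerivAt.const_mul (T f) ?_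
    simpa using HasDerivAt.fun_finsetProd (u := univ) fun j _ => hlin (f j)
  convert hD using 1
  simp only [mul_sum]
  rw [sum_comm]
  have hj : ∀ j : Fin (k + 1), ∑ f : Fin (k + 1) → Fin n,
      T f * ((∏ l ∈ univ.erase j, u (f l)) * (Pi.single i 1 : Fin n → ℝ) (f j)) =
      tApply T u i := by
    intro j
    have h0 : ∑ f : Fin (k + 1) → Fin n,
        T f * ((∏ l ∈ univ.erase 0, u (f l)) * (Pi.single i 1 : Fin n → ℝ) (f 0)) =
        tApply T u i := by
      rw [← (Fin.consEquiv fun _ : Fin (k + 1) => Fin n).sum_comp, Fintype.sum_prod_type,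
        sum_eq_single i]
      · unfold tApply
        refine sum_congr rfl fun g _ => ?_
        have he : (univ.erase 0 : Finset (Fin (k + 1))) = univ.map (Fin.succEmb k) := by
          ext a
          cases a using Fin.cases <;> simp [Fin.succ_ne_zero]
        simp [he, Fin.consEquiv]
      · intro b _ hb
        simp [hb]
      · simp
    rw [← h0, ← (Equiv.arrowCongr (Equiv.swap 0 j) (Equiv.refl (Fin n))).sum_comp]
    refine sum_congr rfl fun f _ => ?_
    have hf : (Equiv.arrowCongr (Equiv.swap 0 j) (Equiv.refl (Fin n))) f =
        f ∘ Equiv.swap 0 j := by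
      ext a; simp [Equiv.arrowCongr]
    rw [hf, hT]
    congr 2
    · refine prod_equiv (Equiv.swap 0 j) (fun l => ?_) (fun l _ => rfl)
      simp [Equiv.swap_apply_eq_iff]
    · simp
  simp [hj]

theorem HasDerivAt.nonneg_of_forall_ge {f : ℝ → ℝ} {f' : ℝ} (hf : HasDerivAt f f' 0)
    (h : ∀ s, 0 < s → f 0 ≤ f s) : 0 ≤ f' := by
  have ht := (hasDerivWithinAt_iff_tendsto_slope' (s := Set.Ioi 0) (by simp)).1
    hf.hasDerivWithinAt
  refine ge_of_tendsto ht ?_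
  filter_upwards [self_mem_nhdsWithin] with s hs
  have hs : 0 < s := hs
  rw [slope_def_field]
  exact div_nonneg (sub_nonneg.2 (h s hs)) (by linarith)

/-- The two-variable weighted arithmetic-geometric mean inequality. -/
theorem add_two_mul_mul_pow_le (k : ℕ) {y w : ℝ} (hy : 0 ≤ y) (hw : 0 ≤ w) :
    (k + 2 : ℝ) * y * w ^ (k + 1) ≤ y ^ (k + 2) + (k + 1) * w ^ (k + 2) := by
  induction k with
  | zero => norm_num; nlinarith [sq_nonneg (y - w)]
  | succ k ih =>
    have h1 := mul_le_mul_of_nonneg_left ih hy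
    have h2 : 0 ≤ (k + 2 : ℝ) * w ^ (k + 1) * (y - w) ^ 2 := by positivity
    push_cast
    ring_nf at h1 h2 ⊢
    linarith

theorem exists_homogeneous_max_of_isClosed_cone {E : Type*} [NormedAddCommGroup E] [NormedSpace ℝ E]
    [ProperSpace E] {K : Set E} (hK : IsClosed K) (hcone : ∀ s : ℝ, 0 ≤ s → ∀ p ∈ K, s • p ∈ K)
    (hne : ∃ p ∈ K, p ≠ 0) {m : ℕ} (hm : m ≠ 0) {f q : E → ℝ} (hf : Continuous f)
    (hq : Continuous q) (hfm : ∀ s p, f (s • p) = s ^ m * f p)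
    (hqm : ∀ s p, q (s • p) = s ^ m * q p) (hpos : ∀ p ∈ K, p ≠ 0 → 0 < q p) :
    ∃ p ∈ K, q p = 1 ∧ ∀ p' ∈ K, f p' ≤ f p * q p' := by
  have hS : IsCompact (K ∩ Metric.sphere (0 : E) 1) := (isCompact_sphere 0 1).inter_left hK
  have hunit : ∀ p ∈ K, p ≠ 0 → ‖p‖⁻¹ • p ∈ K ∩ Metric.sphere (0 : E) 1 := fun p hp h0 =>
    ⟨hcone _ (by positivity) p hp, by simp [norm_smul, h0]⟩
  have hqS : ∀ p ∈ K ∩ Metric.sphere (0 : E) 1, 0 < q p := fun p hp =>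
    hpos p hp.1 (by rintro rfl; simpa using hp.2)
  obtain ⟨p₀, hp₀, h₀⟩ := hne
  obtain ⟨p, hp, hmax⟩ := hS.exists_isMaxOn ⟨_, hunit p₀ hp₀ h₀⟩
    (hf.continuousOn.div hq.continuousOn fun p hp => (hqS p hp).ne')
  have hqp := hqS p hp
  set s := ((q p)⁻¹) ^ ((m : ℝ)⁻¹) with hs
  have hsm : s ^ m = (q p)⁻¹ := Real.rpow_inv_natCast_pow (by positivity) hm
  refine ⟨s • p, hcone s (by positivity) p hp.1, ?_, fun p' hp' => ?_⟩
  · rw [hqm, hsm, inv_mul_cancel₀ hqp.ne']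
  · by_cases h0 : p' = 0
    · have hf0 : f 0 = 0 := by simpa [hm] using hfm 0 0
      have hq0 : q 0 = 0 := by simpa [hm] using hqm 0 0
      simp [h0, hf0, hq0]
    · have h := hmax (hunit p' hp' h0)
      have hq' := hpos p' hp' h0
      have hn : 0 < ‖p'‖⁻¹ ^ m := by positivity
      simp only [Set.mem_ofPred_eq, Pi.div_apply, hfm, hqm] at h
      rw [mul_div_mul_left _ _ hn.ne', div_le_iff₀ hq'] at h
      rw [hfm, hsm]
      calc f p' ≤ f p / q p * q p' := h
        _ = _ := by rw [div_eq_inv_mul]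

theorem phi0_smul {n k : ℕ} (B : (Fin (k + 2) → Fin n) → ℝ) (s : ℝ) (u v : Fin n → ℝ) :
    phi0 B (s • u) (s • v) = s ^ (k + 2) * phi0 B u v := by
  unfold phi0
  have h : ∑ i, (s • v) i * (s • u) i ^ (k + 1) = s ^ (k + 2) * ∑ i, v i * u i ^ (k + 1) := by
    rw [mul_sum]
    refine sum_congr rfl fun i _ => ?_
    simp only [Pi.smul_apply, smul_eq_mul]
    ring
  rw [h, tEval_smul]
  ring

theorem phi0_coeff_pos (k : ℕ) :
    0 < (k + 2 : ℝ) * ((k + 1 : ℝ) ^ ((1 : ℝ) / (k + 2) - 1)) := by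
  positivity

theorem exists_phi0_coeff_eq (k : ℕ) : ∃ d : ℝ, 0 < d ∧ d ^ (k + 2) = k + 1 ∧
    (k + 2 : ℝ) * ((k + 1 : ℝ) ^ ((1 : ℝ) / (k + 2) - 1)) = (k + 2) * d / (k + 1) := by
  have hk : (0 : ℝ) < k + 1 := by positivity
  refine ⟨(k + 1 : ℝ) ^ ((1 : ℝ) / (k + 2)), by positivity, ?_, ?_⟩
  · have h := Real.rpow_inv_natCast_pow hk.le (n := k + 2) (by lia)
    push_cast at h
    rwa [one_div]
  · rw [Real.rpow_sub_one hk.ne']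
    ring

theorem mul_phi0_le {n k : ℕ} {A B : (Fin (k + 2) → Fin n) → ℝ} {lam : ℝ} (hlam : 0 < lam)
    {u v : Fin n → ℝ} (hu : ∀ i, 0 ≤ u i) (hv : ∀ i, 0 ≤ v i) :
    lam * (phi0 B u v - lam ^ (k + 1) * (tEval A u + ∑ i, v i ^ (k + 2))) ≤
      -tEval (triple A B (fun f => -unitT f) lam) u := by
  obtain ⟨d, hd, hdk, hc⟩ := exists_phi0_coeff_eq k
  rw [tEval_triple_neg_unitT]
  unfold phi0
  rw [hc]
  have hk : (0 : ℝ) < k + 1 := by positivity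
  have key : ∑ i, (lam * ((k + 2) * d / (k + 1)) * (v i * u i ^ (k + 1))
      - lam ^ (k + 2) * v i ^ (k + 2)) ≤ ∑ i, u i ^ (k + 2) := by
    refine sum_le_sum fun i _ => ?_
    have h := add_two_mul_mul_pow_le k (mul_nonneg (mul_nonneg hd.le hlam.le) (hv i)) (hu i)
    rw [mul_pow, mul_pow, hdk] at h
    refine le_of_mul_le_mul_left ?_ hk
    calc _ = (k + 2 : ℝ) * (d * lam * v i) * u i ^ (k + 1)
          - (k + 1) * lam ^ (k + 2) * v i ^ (k + 2) := by field_simp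
      _ ≤ _ := by linarith
  rw [sum_sub_distrib, ← mul_sum, ← mul_sum] at key
  have e : lam ^ (k + 2) = lam * lam ^ (k + 1) := by ring
  rw [e] at key ⊢
  linarith

/-- Equality in `mul_phi0_le` when `v` is the appropriate multiple of `u`. -/
theorem exists_mul_phi0_smul_eq {k : ℕ} {lam : ℝ} (hlam : 0 < lam) :
    ∃ t : ℝ, 0 < t ∧ ∀ {n : ℕ} (A B : (Fin (k + 2) → Fin n) → ℝ) (u : Fin n → ℝ),
      lam * (phi0 B u (t • u) - lam ^ (k + 1) * (tEval A u + ∑ i, (t • u) i ^ (k + 2))) =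
        -tEval (triple A B (fun f => -unitT f) lam) u := by
  obtain ⟨d, hd, hdk, hc⟩ := exists_phi0_coeff_eq k
  have hk : (0 : ℝ) < k + 1 := by positivity
  refine ⟨(d * lam)⁻¹, by positivity, fun A B u => ?_⟩
  rw [tEval_triple_neg_unitT]
  unfold phi0
  rw [hc]
  have h1 : ∑ i, ((d * lam)⁻¹ • u) i * u i ^ (k + 1) =
      (d * lam)⁻¹ * ∑ i, u i ^ (k + 2) := by
    rw [mul_sum]
    refine sum_congr rfl fun i _ => ?_
    simp only [Pi.smul_apply, smul_eq_mul]
    ring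
  have h2 : ∑ i, ((d * lam)⁻¹ • u) i ^ (k + 2) =
      ((k + 1) * lam ^ (k + 2))⁻¹ * ∑ i, u i ^ (k + 2) := by
    rw [mul_sum]
    refine sum_congr rfl fun i _ => ?_
    simp only [Pi.smul_apply, smul_eq_mul]
    rw [mul_pow, inv_pow, mul_pow, hdk]
  rw [h1, h2, pow_succ lam (k + 1)]
  field_simp
  ring

/-- If `𝒜, ℬ` are symmetric and `𝒜` strictly copositive, then `φ₀` attains its maximum over
`F`, the set of `m`-degree Pareto-eigenvalues of `(𝒜, ℬ, −ℐ)` has a maximum `λ_max`, and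
`λ_max^{m-1} = φ₀^max`, `m = k + 2`. -/
theorem lambda_max_eq_phi_max (k n : ℕ) (hn : 1 ≤ n)
    (A B : (Fin (k + 2) → Fin n) → ℝ) (hA : IsSymm' A) (hB : IsSymm' B)
    (hscop : ∀ x : Fin n → ℝ, (∀ i, 0 ≤ x i) → x ≠ 0 → 0 < tEval A x) :
    ∃ u v : Fin n → ℝ, Feasible A u v ∧
      (∀ u' v' : Fin n → ℝ, Feasible A u' v' → phi0 B u' v' ≤ phi0 B u v) ∧
      ∃ lamMax : ℝ,
        (∃ x : Fin n → ℝ, IsParetoPair A B (fun f => -unitT f) lamMax x) ∧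
        (∀ lam : ℝ, (∃ x : Fin n → ℝ, IsParetoPair A B (fun f => -unitT f) lam x) →
          lam ≤ lamMax) ∧
        lamMax ^ (k + 1) = phi0 B u v := by
  have hcont : Continuous fun p : (Fin n → ℝ) × (Fin n → ℝ) => phi0 B p.1 p.2 := by
    have := (continuous_tEval B).comp (continuous_fst (Y := Fin n → ℝ))
    unfold phi0
    exact (by fun_prop : Continuous fun p : (Fin n → ℝ) × (Fin n → ℝ) =>
      (k + 2 : ℝ) * ((k + 1 : ℝ) ^ ((1 : ℝ) / (k + 2) - 1)) *
        (∑ i, p.2 i * p.1 i ^ (k + 1))).sub this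
  have hqcont : Continuous fun p : (Fin n → ℝ) × (Fin n → ℝ) =>
      tEval A p.1 + ∑ i, p.2 i ^ (k + 2) :=
    ((continuous_tEval A).comp continuous_fst).add (by fun_prop)
  have hA0 : tEval A 0 = 0 := by simpa using tEval_smul A 0 0
  have hB0 : tEval B 0 = 0 := by simpa using tEval_smul B 0 0
  have hAnn : ∀ x : Fin n → ℝ, (∀ i, 0 ≤ x i) → 0 ≤ tEval A x := fun x hx => by
    by_cases h : x = 0
    · rw [h, hA0]
    · exact (hscop x hx h).le
  obtain ⟨⟨u, v⟩, ⟨hu, hv⟩, hq1, hmax⟩ := exists_homogeneous_max_of_isClosed_cone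
    (K := Set.Ici (0 : (Fin n → ℝ) × (Fin n → ℝ))) isClosed_Ici
    (fun s hs p (hp : 0 ≤ p) => Set.mem_Ici.2 (smul_nonneg hs hp))
    ⟨(fun _ => 1, fun _ => 1), ⟨fun _ => zero_le_one, fun _ => zero_le_one⟩,
      fun h => one_ne_zero (congrFun (congrArg Prod.fst h) ⟨0, hn⟩)⟩
    (m := k + 2) (by lia) hcont hqcont (fun s p => phi0_smul B s p.1 p.2)
    (fun s p => by
      simp only [Prod.smul_fst, Prod.smul_snd, tEval_smul, Pi.smul_apply, smul_eq_mul, mul_pow,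
        ← mul_sum]
      ring)
    (by
      rintro ⟨x, y⟩ ⟨hx, hy⟩ h0
      have hy' : ∀ i, 0 ≤ y i := hy
      by_cases h : x = 0
      · have hy0 : y ≠ 0 := fun h' => h0 (by simp [h, h'])
        obtain ⟨i, hi⟩ := Function.ne_iff.1 hy0
        refine add_pos_of_nonneg_of_pos (hAnn x hx) (sum_pos' (fun j _ => pow_nonneg (hy' j) _)
          ⟨i, mem_univ i, pow_pos ((hy' i).lt_of_ne' hi) _⟩)
      · exact add_pos_of_pos_of_nonneg (hscop x hx h)
          (sum_nonneg fun j _ => pow_nonneg (hy' j) _))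
  replace hmax : ∀ x y : Fin n → ℝ, (∀ i, 0 ≤ x i) → (∀ i, 0 ≤ y i) →
      phi0 B x y ≤ phi0 B u v * (tEval A x + ∑ i, y i ^ (k + 2)) :=
    fun x y hx hy => hmax (x, y) ⟨hx, hy⟩
  replace hq1 : tEval A u + ∑ i, v i ^ (k + 2) = 1 := hq1
  replace hu : ∀ i, 0 ≤ u i := hu
  replace hv : ∀ i, 0 ≤ v i := hv
  have hpos : 0 < phi0 B u v := by
    have hc := phi0_coeff_pos k
    have hn' : (0 : ℝ) < n := by exact_mod_cast hn
    set c := (k + 2 : ℝ) * ((k + 1 : ℝ) ^ ((1 : ℝ) / (k + 2) - 1)) with hcdef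
    set b := tEval B (fun _ => 1)
    set ε := c * n / (|b| + 1) with hε
    have hε0 : 0 < ε := by positivity
    have hεb : ε * b < c * n := by
      have h1 : ε * (|b| + 1) = c * n := div_mul_cancel₀ _ (by positivity)
      have h2 : ε * b ≤ ε * |b| := mul_le_mul_of_nonneg_left (le_abs_self b) hε0.le
      linarith
    have h := hmax (ε • fun _ => 1) (fun _ => 1) (fun _ => by simp [hε0.le])
      (fun _ => zero_le_one)
    have hval : phi0 B (ε • fun _ => 1) (fun _ => 1) = ε ^ (k + 1) * (c * n - ε * b) := by
      unfold phi0
      rw [tEval_smul, ← hcdef]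
      simp
      ring
    have hlt : 0 < ε ^ (k + 1) * (c * n - ε * b) :=
      mul_pos (by positivity) (sub_pos.2 hεb)
    rw [hval] at h
    refine pos_of_mul_pos_left (hlt.trans_le h) (add_nonneg (hAnn _ fun _ => ?_) ?_)
    · simp [hε0.le]
    · exact sum_nonneg fun _ _ => by simp
  have hlam : ∃ lam : ℝ, 0 < lam ∧ lam ^ (k + 1) = phi0 B u v :=
    ⟨phi0 B u v ^ (((k + 1 : ℕ) : ℝ)⁻¹), by positivity,
      Real.rpow_inv_natCast_pow hpos.le (Nat.succ_ne_zero k)⟩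
  obtain ⟨lam, hlam, hpow⟩ := hlam
  have hG : ∀ x : Fin n → ℝ, (∀ i, 0 ≤ x i) →
      0 ≤ tEval (triple A B (fun f => -unitT f) lam) x := fun x hx => by
    obtain ⟨t, ht, h⟩ := exists_mul_phi0_smul_eq (k := k) hlam
    have h1 := h A B x
    have h2 := hmax x (t • x) hx fun i => mul_nonneg ht.le (hx i)
    rw [hpow] at h1
    nlinarith
  have hGu : tEval (triple A B (fun f => -unitT f) lam) u = 0 := by
    refine le_antisymm ?_ (hG u hu)
    have h := mul_phi0_le (A := A) (B := B) hlam hu hv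
    rw [hq1, hpow] at h
    linarith
  refine ⟨u, v, ⟨hu, hv, hq1⟩, fun u' v' h => ?_, lam, ⟨u, ?_, hu, fun i => ?_, ?_⟩, ?_, hpow⟩
  · simpa [h.2.2] using hmax u' v' h.1 h.2.1
  · rintro rfl
    simp [phi0, hB0] at hpos
  · have h := (hasDerivAt_tEval_add_single (isSymm'_triple_neg_unitT hA hB lam)
      u i).nonneg_of_forall_ge fun s hs => by
        rw [zero_smul, add_zero, hGu]
        exact hG _ fun j => add_nonneg (hu j)
          (mul_nonneg hs.le (by by_cases h : j = i <;> simp [h]))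
    exact nonneg_of_mul_nonneg_right h (by positivity)
  · rw [← tEval_eq_sum_tApply, hGu]
  · rintro l ⟨x, hx0, hx, -, hx2⟩
    rcases le_or_gt l 0 with hl | hl
    · exact hl.trans hlam.le
    obtain ⟨t, ht, h⟩ := exists_mul_phi0_smul_eq (k := k) hl
    have h1 := h A B x
    rw [tEval_eq_sum_tApply (triple A B _ l), hx2, neg_zero, mul_eq_zero, or_iff_right hl.ne', sub_eq_zero] at h1
    have htx : ∀ i, 0 ≤ (t • x) i := fun i => mul_nonneg ht.le (hx i)
    have h2 := hmax x (t • x) hx htx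
    rw [h1, ← hpow] at h2
    have hq : 0 < tEval A x + ∑ i, (t • x) i ^ (k + 2) :=
      add_pos_of_pos_of_nonneg (hscop x hx hx0) (sum_nonneg fun i _ => pow_nonneg (htx i) _)
    exact (pow_le_pow_iff_left₀ hl.le hlam.le (Nat.succ_ne_zero k)).1
      (le_of_mul_le_mul_right h2 hq)
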